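/- Let p be prime and let λ be a Z_p-equivariant map from the non-empty faces of E_{n-1}(Z_p) to Z_p × [m], with λ = (λ_1, λ_2) and α ≤ m, satisfying: (1) if A_1 ⊆ A_2 are non-empty faces with λ_2(A_1) = λ_2(A_2) ≤ α, then λ_1(A_1) = λ_1(A_2); (2) if A_1 ⊆ ... ⊆ A_p are non-empty faces with λ_2(A_1) = ... = λ_2(A_p) > α, then λ_1(A_1), ..., λ_1(A_p) are not pairwise distinct. Then α + (m - α)(p - 1) ≥ n. -/

import Mathlib

open Finset

/-- A (non-empty) face of `E_{n-1}(ℤ_p)`: a non-empty subset of `ℤ_p × [n]` on which the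
projection to the second coordinate is injective. -/
def IsEFace (p n : ℕ) (A : Finset (ZMod p × Fin n)) : Prop :=
  A.Nonempty ∧ ∀ a ∈ A, ∀ b ∈ A, a.2 = b.2 → a = b

/-- The action of `ω ∈ ℤ_p` on subsets of `ℤ_p × [n]`, by multiplication (translation)
in the first coordinate. -/
def ESmul (p n : ℕ) (ω : ZMod p) (A : Finset (ZMod p × Fin n)) : Finset (ZMod p × Fin n) :=
  A.image (fun x => (ω + x.1, x.2))

namespace ZpTucker

/-! ### Ordered chains, their boundary and barycentric subdivision -/

section Chains

variable {X Y : Type*}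

/-- An integral chain on lists over `X`, given by its pairing with cochains. -/
abbrev Chain (X : Type*) := (List X → ℤ) →ₗ[ℤ] ℤ

/-- The (augmented) boundary of a list, as a chain. -/
def bd : List X → Chain X
  | [] => 0
  | v :: l => LinearMap.proj l - bd l ∘ₗ LinearMap.funLeft ℤ ℤ (List.cons v)

@[simp] lemma bd_nil (f : List X → ℤ) : bd [] f = 0 := rfl

@[simp] lemma bd_cons (v : X) (l : List X) (f : List X → ℤ) :
    bd (v :: l) f = f l - bd l (fun l' => f (v :: l')) := rfl

lemma bd_bd (l : List X) (f : List X → ℤ) : bd l (fun l' => bd l' f) = 0 := by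
  induction l generalizing f with
  | nil => rfl
  | cons v l ih =>
    have h : (fun l' => bd (v :: l') f) = f - fun l' => bd l' (fun l'' => f (v :: l'')) := by
      ext l'; simp
    rw [bd_cons, h, map_sub, ih, sub_zero, sub_self]

lemma bd_map (g : X → Y) (l : List X) (f : List Y → ℤ) :
    bd (l.map g) f = bd l (fun l' => f (l'.map g)) := by
  induction l generalizing f with
  | nil => rfl
  | cons v l ih => simp [ih]

lemma bd_congr (l : List X) (f g : List X → ℤ)
    (h : ∀ l', l'.Sublist l → l'.length + 1 = l.length → f l' = g l') : bd l f = bd l g := by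
  induction l generalizing f g with
  | nil => rfl
  | cons v l ih =>
    rw [bd_cons, bd_cons, h l (List.sublist_cons_self v l) rfl]
    congr 1
    refine ih _ _ fun l' hl' hlen => h _ (hl'.cons_cons v) ?_
    simp [hlen]

variable [DecidableEq X] [DecidableEq Y]

/-- The barycentric subdivision of a list with `k` entries, as a chain. -/
def sd : ℕ → List X → Chain (Finset X)
  | 0, _ => LinearMap.proj []
  | k + 1, l =>
    bd l ∘ₗ LinearMap.pi (sd k) ∘ₗ LinearMap.funLeft ℤ ℤ (List.cons l.toFinset)

@[simp] lemma sd_zero (l : List X) (f : List (Finset X) → ℤ) : sd 0 l f = f [] := rfl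

lemma sd_succ (k : ℕ) (l : List X) (f : List (Finset X) → ℤ) :
    sd (k + 1) l f = bd l (fun l' => sd k l' (fun w => f (l.toFinset :: w))) := rfl

lemma sd_bd (k : ℕ) (l : List X) (f : List (Finset X) → ℤ) :
    sd (k + 1) l (fun w => bd w f) = bd l (fun l' => sd k l' f) := by
  induction k generalizing l f with
  | zero =>
    rw [sd_succ]
    simp
  | succ k ih =>
    rw [sd_succ]
    have h : (fun l' => sd (k + 1) l' (fun w => bd (l.toFinset :: w) f)) =
        (fun l' => sd (k + 1) l' f) -
          fun l' => bd l' (fun l'' => sd k l'' (fun w => f (l.toFinset :: w))) := by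
      ext l'
      rw [Pi.sub_apply, ← ih, ← map_sub]
      rfl
    rw [h, map_sub, bd_bd, sub_zero]

lemma sd_map (g : X → Y) (k : ℕ) (l : List X) (f : List (Finset Y) → ℤ) :
    sd k (l.map g) f = sd k l (fun w => f (w.map (Finset.image g))) := by
  induction k generalizing l f with
  | zero => rfl
  | succ k ih =>
    have h : (l.map g).toFinset = l.toFinset.image g := by
      ext; simp
    simp only [sd_succ, bd_map, ih, h, List.map_cons]

lemma sd_congr (k : ℕ) (l : List X) (hl : l.length = k) (f g : List (Finset X) → ℤ)
    (h : ∀ w : List (Finset X), w.length = k → w.Pairwise (fun a b => b ⊆ a) →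
      (∀ x ∈ w, x.Nonempty ∧ x ⊆ l.toFinset) → f w = g w) : sd k l f = sd k l g := by
  induction k generalizing l f g with
  | zero => exact h [] rfl List.Pairwise.nil (by simp)
  | succ k ih =>
    rw [sd_succ, sd_succ]
    refine bd_congr _ _ _ fun l' hl' hlen => ih l' (by omega) _ _ fun w hw hp hx => ?_
    have hsub : l'.toFinset ⊆ l.toFinset := fun x hx => by
      rw [List.mem_toFinset] at hx ⊢
      exact hl'.subset hx
    refine h _ (by simp [hw]) (List.pairwise_cons.2 ⟨fun x hxw => (hx x hxw).2.trans hsub, hp⟩) ?_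
    intro x hxw
    rcases List.mem_cons.1 hxw with rfl | hxw
    · refine ⟨?_, subset_rfl⟩
      rw [List.toFinset_nonempty_iff]
      rintro rfl
      simp at hl
    · exact ⟨(hx x hxw).1, (hx x hxw).2.trans hsub⟩

/-- The second barycentric subdivision of a list with `k` entries, as a chain. -/
def sdSq (k : ℕ) (l : List X) : Chain (Finset (Finset X)) :=
  sd k l ∘ₗ LinearMap.pi (sd k)

lemma sdSq_apply (k : ℕ) (l : List X) (f : List (Finset (Finset X)) → ℤ) :
    sdSq k l f = sd k l (fun l' => sd k l' f) := rfl

lemma sdSq_bd (k : ℕ) (l : List X) (f : List (Finset (Finset X)) → ℤ) :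
    sdSq (k + 1) l (fun w => bd w f) = bd l (fun l' => sdSq k l' f) := by
  simp only [sdSq_apply, sd_bd]

lemma sdSq_map (g : X → Y) (k : ℕ) (l : List X) (f : List (Finset (Finset Y)) → ℤ) :
    sdSq k (l.map g) f = sdSq k l (fun w => f (w.map (Finset.image (Finset.image g)))) := by
  simp only [sdSq_apply, sd_map]

lemma sdSq_congr (k : ℕ) (l : List X) (hl : l.length = k)
    (f g : List (Finset (Finset X)) → ℤ)
    (h : ∀ w : List (Finset (Finset X)), w.length = k → w.Pairwise (fun a b => b ⊆ a) →
      (∀ C ∈ w, C.Nonempty ∧ (∀ A ∈ C, A.Nonempty ∧ A ⊆ l.toFinset) ∧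
        ∀ A ∈ C, ∀ B ∈ C, A ⊆ B ∨ B ⊆ A) → f w = g w) : sdSq k l f = sdSq k l g := by
  refine sd_congr k l hl _ _ fun u hu hup hux => sd_congr k u hu _ _ fun w hw hwp hwx => ?_
  refine h w hw hwp fun C hC => ⟨(hwx C hC).1, fun A hA => ?_, fun A hA B hB => ?_⟩
  · exact hux A (List.mem_toFinset.1 ((hwx C hC).2 hA))
  · have : Std.Symm (fun A B : Finset X => A ⊆ B ∨ B ⊆ A) := ⟨fun _ _ h => h.symm⟩
    refine List.Pairwise.forall_of_forall (R := fun A B : Finset X => A ⊆ B ∨ B ⊆ A)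
      (fun A _ => Or.inl subset_rfl) (hup.imp Or.inr) ?_ ?_
    · exact List.mem_toFinset.1 ((hwx C hC).2 hA)
    · exact List.mem_toFinset.1 ((hwx C hC).2 hB)

end Chains

/-! ### The operators `g - 1` and `1 + g + ⋯ + g ^ (p - 1)` -/

section Operators

variable {p : ℕ} [NeZero p] {X Y : Type*}

/-- `g - 1` for odd `k`, and the norm `∑ g ^ i` for even `k`, acting on cochains. -/
def dif (σ : ZMod p → X → X) (k : ℕ) : (List X → ℤ) →ₗ[ℤ] (List X → ℤ) :=
  if Odd k then LinearMap.funLeft ℤ ℤ (List.map (σ 1)) - LinearMap.id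
  else ∑ ω, LinearMap.funLeft ℤ ℤ (List.map (σ ω))

lemma dif_odd (σ : ZMod p → X → X) {k : ℕ} (hk : Odd k) (f : List X → ℤ) (l : List X) :
    dif σ k f l = f (l.map (σ 1)) - f l := by
  simp [dif, hk, LinearMap.funLeft]

lemma dif_even (σ : ZMod p → X → X) {k : ℕ} (hk : ¬ Odd k) (f : List X → ℤ) (l : List X) :
    dif σ k f l = ∑ ω, f (l.map (σ ω)) := by
  simp [dif, hk, LinearMap.funLeft]

lemma dif_comp (σ : ZMod p → X → X) (hσ : ∀ a b x, σ a (σ b x) = σ (a + b) x)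
    (k : ℕ) (f : List X → ℤ) : dif σ k (dif σ (k + 1) f) = 0 := by
  have hm : ∀ a b (l : List X), (l.map (σ b)).map (σ a) = l.map (σ (a + b)) := by
    intro a b l
    simp [List.map_map, Function.comp_def, hσ]
  ext l
  by_cases hk : Odd k
  · have hk' : ¬ Odd (k + 1) := by
      rw [Nat.not_odd_iff_even]
      exact hk.add_one
    rw [dif_odd σ hk, dif_even σ hk', dif_even σ hk']
    simp only [hm]
    rw [Pi.zero_apply, sub_eq_zero]
    exact Fintype.sum_equiv (Equiv.addRight 1) _ _ fun _ => rfl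
  · have hk' : Odd (k + 1) := (Nat.not_odd_iff_even.1 hk).add_one
    rw [dif_even σ hk]
    simp only [dif_odd σ hk', hm, Finset.sum_sub_distrib]
    rw [Pi.zero_apply, sub_eq_zero]
    exact Fintype.sum_equiv (Equiv.addLeft 1) _ _ fun _ => rfl

/-- A family of functionals compatible with the actions commutes with `dif`. -/
lemma dif_apply_of_equivariant (σ : ZMod p → X → X) (τ : ZMod p → Y → Y) (k : ℕ)
    (Φ : List X → Chain Y) (l : List X) (f : List Y → ℤ)
    (h : ∀ ω f, Φ (l.map (σ ω)) f = Φ l (fun w => f (w.map (τ ω)))) :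
    dif σ k (fun l => Φ l f) l = Φ l (dif τ k f) := by
  by_cases hk : Odd k
  · rw [dif_odd σ hk, h, ← map_sub]
    congr 1
    ext w
    rw [dif_odd τ hk]
    rfl
  · rw [dif_even σ hk]
    simp only [h]
    rw [← map_sum]
    congr 1
    ext w
    rw [dif_even τ hk, Finset.sum_apply]

/-- Iterated cones: `c 0 = v 0` and `c (k + 1) = v (k + 1) * dif (c k)`. -/
def coneChain (σ : ZMod p → X → X) (v : ℕ → X) : ℕ → Chain X
  | 0 => LinearMap.proj [v 0]
  | k + 1 => coneChain σ v k ∘ₗ dif σ (k + 1) ∘ₗ LinearMap.funLeft ℤ ℤ (List.cons (v (k + 1)))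

lemma coneChain_succ (σ : ZMod p → X → X) (v : ℕ → X) (k : ℕ) (f : List X → ℤ) :
    coneChain σ v (k + 1) f =
      coneChain σ v k (dif σ (k + 1) (fun l => f (v (k + 1) :: l))) := rfl

lemma coneChain_bd (σ : ZMod p → X → X) (hσ : ∀ a b x, σ a (σ b x) = σ (a + b) x)
    (v : ℕ → X) (k : ℕ) (f : List X → ℤ) :
    coneChain σ v (k + 1) (fun l => bd l f) = coneChain σ v k (dif σ (k + 1) f) := by
  induction k generalizing f with
  | zero =>
    rw [coneChain_succ]
    change dif σ 1 _ [v 0] = dif σ 1 f [v 0]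
    rw [dif_odd σ odd_one, dif_odd σ odd_one]
    simp
  | succ k ih =>
    rw [coneChain_succ]
    have h : (fun l => bd (v (k + 1 + 1) :: l) f) =
        f - fun l => bd l (fun l' => f (v (k + 1 + 1) :: l')) := rfl
    rw [h, map_sub, map_sub]
    have h' : dif σ (k + 1 + 1) (fun l => bd l (fun l' => f (v (k + 1 + 1) :: l'))) =
        fun l => bd l (dif σ (k + 1 + 1) (fun l' => f (v (k + 1 + 1) :: l'))) := by
      ext l
      exact dif_apply_of_equivariant σ σ _ bd l _ fun ω f => bd_map _ _ _
    rw [h', ih, dif_comp σ hσ, map_zero, sub_zero]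

lemma coneChain_congr (σ : ZMod p → X → X) (v : ℕ → X) (col : X → ℕ)
    (hcol : ∀ ω x, col (σ ω x) = col x) (k : ℕ) (hv : ∀ i ≤ k, col (v i) = i)
    (f g : List X → ℤ)
    (h : ∀ l : List X, l.length = k + 1 → l.Pairwise (fun a b => col b < col a) →
      (∀ x ∈ l, col x ≤ k) → f l = g l) :
    coneChain σ v k f = coneChain σ v k g := by
  induction k generalizing f g with
  | zero =>
    refine h [v 0] rfl (by simp) ?_
    simp [hv 0]
  | succ k ih =>
    rw [coneChain_succ, coneChain_succ]
    refine ih (fun i hi => hv i (by omega)) _ _ fun l hl hp hx => ?_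
    have key : ∀ l : List X, l.length = k + 1 → l.Pairwise (fun a b => col b < col a) →
        (∀ x ∈ l, col x ≤ k) → f (v (k + 1) :: l) = g (v (k + 1) :: l) := by
      intro l hl hp hx
      refine h _ (by simp [hl]) (List.pairwise_cons.2 ⟨fun x hxl => ?_, hp⟩) fun x hxl => ?_
      · rw [hv _ le_rfl]
        exact Nat.lt_succ_of_le (hx x hxl)
      · rcases List.mem_cons.1 hxl with rfl | hxl
        · exact (hv _ le_rfl).le
        · exact (hx x hxl).trans (Nat.le_succ k)
    have key' : ∀ ω, f (v (k + 1) :: l.map (σ ω)) = g (v (k + 1) :: l.map (σ ω)) := by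
      intro ω
      refine key _ (by simp [hl]) ?_ ?_
      · rw [List.pairwise_map]
        simpa only [hcol] using hp
      · simpa [hcol] using hx
    by_cases hk : Odd (k + 1)
    · rw [dif_odd σ hk, dif_odd σ hk, key', key l hl hp hx]
    · rw [dif_even σ hk, dif_even σ hk]
      exact Finset.sum_congr rfl fun ω _ => key' ω

end Operators

/-! ### Cocycles of the cyclic group -/

section Cocycles

variable {p : ℕ}

/-- The carry cocycle `(val (b - a) + val (c - b) - val (c - a)) / p`. -/
def carry (a b c : ZMod p) : ℤ :=
  (((b - a).val : ℤ) + (c - b).val - (c - a).val) / p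

lemma mul_carry [NeZero p] (a b c : ZMod p) :
    (p : ℤ) * carry a b c = ((b - a).val : ℤ) + (c - b).val - (c - a).val := by
  refine Int.mul_ediv_cancel' ?_
  rw [← ZMod.intCast_zmod_eq_zero_iff_dvd]
  push_cast
  simp

/-- The cocycle in degree `2 j`, a `j`-fold product of carries. -/
def evenCocycle : ℕ → List (ZMod p) → ℤ
  | 0, [_] => 1
  | j + 1, a :: b :: c :: l => carry a b c * evenCocycle j (c :: l)
  | _, _ => 0

/-- An integral lift of the mod `p` cocycle in degree `2 j + 1`. -/
def oddCocycle (j : ℕ) : List (ZMod p) → ℤ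
  | a :: b :: l => ((b - a).val : ℤ) * evenCocycle j (b :: l)
  | _ => 0

lemma bd_const_mul {X : Type*} (l : List X) (z : ℤ) (f : List X → ℤ) :
    bd l (fun l' => z * f l') = z * bd l f := by
  have := (bd l).map_smul z f
  simpa [Pi.smul_def] using this

@[simp] lemma bd_zero {X : Type*} (l : List X) : bd l (fun _ => 0) = 0 := (bd l).map_zero

lemma bd_oddCocycle_of_bd_evenCocycle [NeZero p] (j : ℕ)
    (h : ∀ l : List (ZMod p), bd l (evenCocycle j) = 0) (l : List (ZMod p)) :
    bd l (oddCocycle j) = p * evenCocycle (j + 1) l := by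
  match l with
  | [] => simp [evenCocycle]
  | [a] => simp [oddCocycle, evenCocycle]
  | [a, b] => simp [oddCocycle, evenCocycle]
  | a :: b :: c :: l =>
    have h' := h (b :: c :: l)
    rw [bd_cons] at h'
    simp only [bd_cons (l := b :: c :: l), bd_cons (l := c :: l), oddCocycle, evenCocycle,
      bd_const_mul, ← mul_assoc, mul_carry]
    rw [← sub_eq_zero.1 h']
    ring

lemma bd_evenCocycle [NeZero p] (j : ℕ) (l : List (ZMod p)) : bd l (evenCocycle j) = 0 := by
  induction j generalizing l with
  | zero =>
    match l with
    | [] => rfl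
    | [a] => simp [evenCocycle]
    | [a, b] => simp [evenCocycle]
    | a :: b :: c :: l => simp [evenCocycle]
  | succ j ih =>
    have hp : (p : ℤ) ≠ 0 := by exact_mod_cast NeZero.ne p
    refine (mul_eq_zero.1 (?_ : (p : ℤ) * _ = 0)).resolve_left hp
    rw [← bd_const_mul]
    simp only [← bd_oddCocycle_of_bd_evenCocycle j ih, bd_bd]

lemma evenCocycle_map (j : ℕ) (ω : ZMod p) (l : List (ZMod p)) :
    evenCocycle j (l.map (ω + ·)) = evenCocycle j l := by
  induction j generalizing l with
  | zero => match l with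
    | [] => rfl
    | [a] => rfl
    | a :: b :: l => rfl
  | succ j ih => match l with
    | [] => rfl
    | [a] => rfl
    | [a, b] => rfl
    | a :: b :: c :: l =>
      have := ih (c :: l)
      simp only [List.map_cons] at this
      simp [evenCocycle, carry, this]

lemma oddCocycle_map (j : ℕ) (ω : ZMod p) (l : List (ZMod p)) :
    oddCocycle j (l.map (ω + ·)) = oddCocycle j l := by
  match l with
  | [] => rfl
  | [a] => rfl
  | a :: b :: l =>
    have := evenCocycle_map j ω (b :: l)
    simp only [List.map_cons] at this
    simp [oddCocycle, this]

lemma isChain_of_evenCocycle_ne_zero (j : ℕ) (l : List (ZMod p)) (h : evenCocycle j l ≠ 0) :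
    l.IsChain (· ≠ ·) := by
  induction j generalizing l with
  | zero => match l with
    | [] => simp
    | [a] => simp
    | a :: b :: l => exact absurd rfl h
  | succ j ih => match l with
    | [] => simp
    | [a] => simp
    | [a, b] => exact absurd rfl h
    | a :: b :: c :: l =>
      have h' := mul_ne_zero_iff.1 h
      refine List.isChain_cons_cons.2 ⟨?_, List.isChain_cons_cons.2 ⟨?_, ih _ h'.2⟩⟩
      · rintro rfl
        exact h'.1 (by simp [carry])
      · rintro rfl
        exact h'.1 (by simp [carry])

lemma isChain_of_oddCocycle_ne_zero (j : ℕ) (l : List (ZMod p)) (h : oddCocycle j l ≠ 0) :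
    l.IsChain (· ≠ ·) := by
  match l with
  | [] => simp
  | [a] => simp
  | a :: b :: l =>
    have h' := mul_ne_zero_iff.1 h
    refine List.isChain_cons_cons.2 ⟨?_, isChain_of_evenCocycle_ne_zero j _ h'.2⟩
    rintro rfl
    exact h'.1 (by simp)

/-- The cocycle in degree `k`. -/
def cocycle (k : ℕ) : List (ZMod p) → ℤ :=
  if Odd k then oddCocycle (k / 2) else evenCocycle (k / 2)

lemma isChain_of_cocycle_ne_zero (k : ℕ) (l : List (ZMod p)) (h : cocycle k l ≠ 0) :
    l.IsChain (· ≠ ·) := by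
  unfold cocycle at h
  split_ifs at h
  · exact isChain_of_oddCocycle_ne_zero _ l h
  · exact isChain_of_evenCocycle_ne_zero _ l h

lemma map_modEq {Z : Type*} (H : (Z → ℤ) →ₗ[ℤ] ℤ) (q : ℤ) (f g : Z → ℤ)
    (h : ∀ z, f z ≡ g z [ZMOD q]) : H f ≡ H g [ZMOD q] := by
  choose e he using fun z => (h z).dvd
  refine Int.modEq_iff_dvd.2 ⟨H e, ?_⟩
  rw [← map_sub, ← smul_eq_mul, ← map_smul]
  congr 1
  ext z
  simpa using he z

/-- Functionals that intertwine the boundary with the alternating operators pair with the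
cocycles to `1` modulo `p`. -/
lemma pairing_cocycle_modEq [NeZero p] (H : ℕ → Chain (ZMod p)) (N : ℕ)
    (h0 : H 0 (cocycle 0) = 1)
    (hH : ∀ k < N, ∀ f, H (k + 1) (fun l => bd l f) =
      H k (dif (fun ω a => ω + a) (k + 1) f)) (k : ℕ) (hk : k ≤ N) :
    H k (cocycle k) ≡ 1 [ZMOD p] := by
  have hp : (p : ℤ) ≠ 0 := by exact_mod_cast NeZero.ne p
  induction k with
  | zero => rw [h0]
  | succ k ih =>
    refine Int.ModEq.trans ?_ (ih (by omega))
    by_cases hodd : Odd (k + 1)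
    · have hk' : ¬ Odd k := by
        rw [Nat.not_odd_iff_even]
        rcases hodd with ⟨j, hj⟩
        exact ⟨j, by omega⟩
      have hdiv : (k + 1) / 2 = k / 2 := by
        rcases hodd with ⟨j, hj⟩
        omega
      simp only [cocycle, hodd, hk', if_true, if_false, hdiv]
      set j := k / 2
      let θ : List (ZMod p) → ℤ := fun l => match l with
        | [] => 0
        | a :: l => (a.val : ℤ) * evenCocycle j (a :: l)
      have e1 : H (k + 1) (oddCocycle j) ≡ H (k + 1) (fun l => bd l θ) [ZMOD p] := by
        refine map_modEq _ _ _ _ fun l => ?_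
        match l with
        | [] => rfl
        | [a] => simp [oddCocycle, θ]
        | a :: b :: l =>
          have h' := bd_evenCocycle j (a :: b :: l)
          rw [bd_cons] at h'
          rw [bd_cons]
          simp only [θ, bd_const_mul, ← sub_eq_zero.1 h', oddCocycle]
          rw [← sub_mul]
          refine Int.ModEq.mul_right _ ?_
          rw [← ZMod.intCast_eq_intCast_iff]
          push_cast
          simp
      rw [hH k (by omega)] at e1
      refine e1.trans (map_modEq _ _ _ _ fun l => ?_)
      rw [dif_odd _ hodd]
      match l with
      | [] =>
        have : evenCocycle j ([] : List (ZMod p)) = 0 := by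
          cases j <;> rfl
        simp only [List.map_nil, sub_self, this]
        rfl
      | a :: l =>
        have := evenCocycle_map j 1 (a :: l)
        simp only [List.map_cons] at this
        simp only [θ, List.map_cons, this]
        rw [← sub_mul]
        conv_rhs => rw [← one_mul (evenCocycle j (a :: l))]
        refine Int.ModEq.mul_right _ ?_
        rw [← ZMod.intCast_eq_intCast_iff]
        push_cast
        simp
    · have hk' : Odd k := by
        rw [Nat.not_odd_iff_even] at hodd
        rcases hodd with ⟨j, hj⟩
        exact ⟨j - 1, by omega⟩
      have hdiv : (k + 1) / 2 = k / 2 + 1 := by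
        rcases hk' with ⟨j, hj⟩
        omega
      simp only [cocycle, hodd, hk', if_true, if_false, hdiv]
      set j := k / 2
      have e := hH k (by omega) (oddCocycle j)
      have e1 : (fun l : List (ZMod p) => bd l (oddCocycle j)) =
          (p : ℤ) • evenCocycle (j + 1) := by
        ext l
        simpa using bd_oddCocycle_of_bd_evenCocycle j (bd_evenCocycle j) l
      have e2 : dif (fun ω a : ZMod p => ω + a) (k + 1) (oddCocycle j) =
          (p : ℤ) • oddCocycle j := by
        ext l
        rw [dif_even _ hodd]
        simp [oddCocycle_map, ZMod.card]
      rw [e1, e2, map_smul, map_smul, smul_eq_mul, smul_eq_mul] at e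
      rw [mul_left_cancel₀ hp e]

end Cocycles

/-! ### Equivariant maps to a join of copies of `ℤ_p` -/

section Maps

variable {p n : ℕ}

/-- A non-empty set of faces that is totally ordered by inclusion. -/
def IsFlag (p n : ℕ) (C : Finset (Finset (ZMod p × Fin n))) : Prop :=
  C.Nonempty ∧ (∀ A ∈ C, IsEFace p n A) ∧ ∀ A ∈ C, ∀ B ∈ C, A ⊆ B ∨ B ⊆ A

/-- Dold's theorem for the second barycentric subdivision of `E_{n-1}(ℤ_p)` and the join of `d`
copies of `ℤ_p`: an equivariant map forces `n ≤ d`. -/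
theorem le_of_equivariant [NeZero p] (hp : 1 < p) (d : ℕ)
    (s : Finset (Finset (ZMod p × Fin n)) → ZMod p)
    (r : Finset (Finset (ZMod p × Fin n)) → ℕ)
    (hr : ∀ C, IsFlag p n C → 1 ≤ r C ∧ r C ≤ d)
    (hs : ∀ ω C, IsFlag p n C → s (C.image (ESmul p n ω)) = ω + s C)
    (hmono : ∀ C C', IsFlag p n C → IsFlag p n C' → C ⊆ C' →
      r C ≤ r C' ∧ (r C = r C' → s C = s C')) : n ≤ d := by
  by_contra! hdn
  have : NeZero n := ⟨by omega⟩
  let σ : ZMod p → ZMod p × Fin n → ZMod p × Fin n := fun ω x => (ω + x.1, x.2)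
  have hσ : ∀ a b x, σ a (σ b x) = σ (a + b) x := fun a b x => by simp [σ, add_assoc]
  let v : ℕ → ZMod p × Fin n := fun i => (0, Fin.ofNat n i)
  let H : ℕ → Chain (ZMod p) := fun k => coneChain σ v k ∘ₗ
    LinearMap.pi (sdSq (k + 1)) ∘ₗ LinearMap.funLeft ℤ ℤ (List.map s)
  have hHdef : ∀ k f, H k f =
    coneChain σ v k (fun l => sdSq (k + 1) l (fun w => f (w.map s))) := fun _ _ => rfl
  have hcongr : ∀ k < n, ∀ f g : List (Finset (Finset (ZMod p × Fin n))) → ℤ,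
      (∀ w : List (Finset (Finset (ZMod p × Fin n))), w.length = k + 1 →
        w.Pairwise (fun a b => b ⊆ a) → (∀ C ∈ w, IsFlag p n C) → f w = g w) →
      coneChain σ v k (fun l => sdSq (k + 1) l f) =
        coneChain σ v k (fun l => sdSq (k + 1) l g) := by
    intro k hk f g hfg
    refine coneChain_congr σ v (fun x => x.2) (fun _ _ => rfl) k (fun i hi => ?_) _ _
      fun l hl hlp _ => ?_
    · simpa [v] using Nat.mod_eq_of_lt (by omega : i < n)
    · refine sdSq_congr (k + 1) l hl _ _ fun w hw hwp hwC => hfg w hw hwp fun C hC => ?_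
      obtain ⟨hne, hA, hcomp⟩ := hwC C hC
      refine ⟨hne, fun A hAC => ⟨(hA A hAC).1, fun a ha b hb hab => ?_⟩, hcomp⟩
      have ha' := List.mem_toFinset.1 ((hA A hAC).2 ha)
      have hb' := List.mem_toFinset.1 ((hA A hAC).2 hb)
      have : Std.Symm (fun a b : ZMod p × Fin n => a.2 = b.2 → a = b) :=
        ⟨fun _ _ h e => (h e.symm).symm⟩
      refine List.Pairwise.forall_of_forall
        (R := fun a b : ZMod p × Fin n => a.2 = b.2 → a = b) (fun _ _ _ => rfl) (hlp.imp ?_) ha' hb' hab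
      intro a b hlt e
      rw [e] at hlt
      exact absurd hlt (lt_irrefl _)
  have h0 : H 0 (cocycle 0) = 1 := by
    rw [hHdef]
    simp [coneChain, sdSq_apply, sd_succ, cocycle, evenCocycle]
  have hH : ∀ k < n, ∀ f, H (k + 1) (fun l => bd l f) =
      H k (dif (fun ω a => ω + a) (k + 1) f) := by
    intro k hk f
    rw [hHdef, hHdef]
    simp only [bd_map, sdSq_bd]
    rw [coneChain_bd σ hσ]
    have e : dif σ (k + 1) (fun l => sdSq (k + 1) l (fun w => f (w.map s))) =
        fun l => sdSq (k + 1) l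
          (dif (fun ω => Finset.image (Finset.image (σ ω))) (k + 1) (fun w => f (w.map s))) := by
      ext l
      exact dif_apply_of_equivariant _ _ _ _ _ _ fun ω f => sdSq_map _ _ _ _
    rw [e]
    refine hcongr k hk _ _ fun w _ _ hw => ?_
    have hmap : ∀ ω, (w.map (Finset.image (Finset.image (σ ω)))).map s =
        (w.map s).map (ω + ·) := by
      intro ω
      rw [List.map_map, List.map_map]
      exact List.map_congr_left fun C hC => hs ω C (hw C hC)
    by_cases hodd : Odd (k + 1)
    · rw [dif_odd _ hodd, dif_odd _ hodd, hmap]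
    · rw [dif_even _ hodd, dif_even _ hodd]
      simp only [hmap]
  have h1 := pairing_cocycle_modEq H n h0 hH (n - 1) (by omega)
  have h2 : H (n - 1) (cocycle (n - 1)) = 0 := by
    rw [hHdef, hcongr (n - 1) (by omega) _ 0]
    · exact (congrArg _ (funext fun l => map_zero _)).trans (map_zero _)
    · intro w hw hwp hwC
      by_contra hne
      have hch := isChain_of_cocycle_ne_zero _ _ hne
      rw [List.isChain_map] at hch
      have hlt : (w.map r).IsChain (· > ·) := by
        rw [List.isChain_map, List.isChain_iff_getElem]
        intro i hi
        have hm := hmono _ _ (hwC _ (List.getElem_mem hi)) (hwC _ (List.getElem_mem (by omega)))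
          (List.pairwise_iff_getElem.1 hwp i (i + 1) (by omega) hi (by omega))
        exact lt_of_le_of_ne hm.1 fun e =>
          List.isChain_iff_getElem.1 hch i hi (hm.2 e).symm
      have hnd : (w.map r).Nodup := (List.isChain_iff_pairwise.1 hlt).imp fun h => h.ne'
      have hcard : (w.map r).toFinset.card ≤ (Finset.Icc 1 d).card := by
        refine Finset.card_le_card fun x hx => ?_
        obtain ⟨C, hC, rfl⟩ := List.mem_map.1 (List.mem_toFinset.1 hx)
        exact Finset.mem_Icc.2 (hr C (hwC C hC))
      rw [List.toFinset_card_of_nodup hnd, List.length_map, hw, Nat.card_Icc] at hcard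
      omega
  rw [h2] at h1
  have := h1.dvd
  norm_num at this
  have h3 := Int.le_of_dvd one_pos this
  omega

/-- A choice of base point in every free orbit. -/
lemma exists_equivariant {X : Type*} (σ : ZMod p → X → X) (h0 : ∀ x, σ 0 x = x)
    (hσ : ∀ a b x, σ a (σ b x) = σ (a + b) x) :
    ∃ s : X → ZMod p, ∀ x, (∀ ω, σ ω x = x → ω = 0) → ∀ ω, s (σ ω x) = ω + s x := by
  let S : Setoid X :=
    { r := fun x y => ∃ ω, σ ω x = y
      iseqv :=
        { refl := fun x => ⟨0, h0 x⟩
          symm := by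
            rintro x _ ⟨ω, rfl⟩
            exact ⟨-ω, by rw [hσ, neg_add_cancel, h0]⟩
          trans := by
            rintro x _ _ ⟨a, rfl⟩ ⟨b, rfl⟩
            exact ⟨b + a, (hσ _ _ _).symm⟩ } }
  have hout : ∀ x, ∃ ω, σ ω (Quotient.out (Quotient.mk S x)) = x := fun x =>
    Quotient.exact (Quotient.out_eq (Quotient.mk S x))
  choose s hs using hout
  refine ⟨s, fun x hx ω => ?_⟩
  have hq : Quotient.mk S (σ ω x) = Quotient.mk S x :=
    (Quotient.sound (show S.r x (σ ω x) from ⟨ω, rfl⟩)).symm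
  have h1 := hs (σ ω x)
  rw [hq] at h1
  have h2 := hs x
  have h3 : σ (-s x) x = Quotient.out (Quotient.mk S x) := by
    have h4 := congrArg (σ (-s x)) h2
    rw [hσ, neg_add_cancel, h0] at h4
    exact h4.symm
  rw [← h3, hσ] at h1
  have h4 := hx (-ω + (s (σ ω x) + -s x)) (by rw [← hσ, h1, hσ, neg_add_cancel, h0])
  linear_combination h4

/-- A non-empty set of labels that contains no full orbit has trivial stabilizer. -/
lemma eq_zero_of_image_eq [Fact p.Prime] {T : Finset (ZMod p × ℕ)} (hT : T.Nonempty)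
    (hfull : ∀ j, ∃ a, (a, j) ∉ T) (ω : ZMod p)
    (h : T.image (fun x => (ω + x.1, x.2)) = T) : ω = 0 := by
  obtain ⟨⟨a, j⟩, ha⟩ := hT
  obtain ⟨b, hb⟩ := hfull j
  by_contra hω
  have hk : ∀ k : ℕ, ((k : ZMod p) * ω + a, j) ∈ T := by
    intro k
    induction k with
    | zero => simpa using ha
    | succ k ih =>
      rw [← h]
      refine Finset.mem_image.2 ⟨_, ih, Prod.ext ?_ rfl⟩
      push_cast
      ring
  refine hb ?_
  have := hk ((b - a) / ω).val
  rwa [ZMod.natCast_zmod_val, div_mul_cancel₀ _ hω, sub_add_cancel] at this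

/-- Size bound for a set of labels with at most one label of each index at most `α` and no
full orbit of labels. -/
lemma card_labels_le (hp : p.Prime) {m α : ℕ} (hα : α ≤ m) (T : Finset (ZMod p × ℕ))
    (hrange : ∀ x ∈ T, 1 ≤ x.2 ∧ x.2 ≤ m)
    (hone : ∀ x ∈ T, ∀ y ∈ T, x.2 = y.2 → x.2 ≤ α → x = y)
    (hfull : ∀ j, ∃ a, (a, j) ∉ T) : T.card ≤ α + (m - α) * (p - 1) := by
  have : Fact p.Prime := ⟨hp⟩
  have hmaps : ∀ x ∈ T, x.2 ∈ Finset.Ioc 0 m := fun x hx =>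
    Finset.mem_Ioc.2 ⟨(hrange x hx).1, (hrange x hx).2⟩
  rw [Finset.card_eq_sum_card_fiberwise hmaps,
    ← Finset.sum_Ioc_consecutive _ (Nat.zero_le α) hα]
  refine add_le_add ?_ ?_
  · refine (Finset.sum_le_card_nsmul _ _ 1 fun j hj => ?_).trans (by simp)
    refine Finset.card_le_one.2 fun x hx y hy => ?_
    rw [Finset.mem_filter] at hx hy
    rw [Finset.mem_Ioc] at hj
    exact hone x hx.1 y hy.1 (hx.2.trans hy.2.symm) (hx.2.trans_le hj.2)
  · refine (Finset.sum_le_card_nsmul _ _ (p - 1) fun j _ => ?_).trans (by simp)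
    obtain ⟨a, ha⟩ := hfull j
    have hinj : Set.InjOn Prod.fst (T.filter (fun x => x.2 = j) : Set (ZMod p × ℕ)) := by
      intro x hx y hy hxy
      simp only [Finset.coe_filter, Set.mem_ofPred_eq] at hx hy
      exact Prod.ext hxy (hx.2.trans hy.2.symm)
    rw [← Finset.card_image_of_injOn hinj]
    have hlt : ((T.filter (fun x => x.2 = j)).image Prod.fst).card < Fintype.card (ZMod p) := by
      refine Finset.card_lt_univ_of_notMem (x := a) fun hmem => ?_
      obtain ⟨⟨b, i⟩, hx, rfl⟩ := Finset.mem_image.1 hmem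
      obtain ⟨hxT, hxj⟩ := Finset.mem_filter.1 hx
      exact ha (hxj ▸ hxT)
    rw [ZMod.card] at hlt
    omega

/-- Finite sets that are pairwise comparable can be enumerated increasingly. -/
lemma exists_monotone_enum {X : Type*} [DecidableEq X] {k : ℕ} (D : Finset (Finset X))
    (hD : D.card = k) (hcomp : ∀ A ∈ D, ∀ B ∈ D, A ⊆ B ∨ B ⊆ A) :
    ∃ A : Fin k → Finset X, (∀ i, A i ∈ D) ∧ Function.Injective A ∧
      ∀ i j, i ≤ j → A i ⊆ A j := by
  have hcard : ∀ A ∈ D, ∀ B ∈ D, A.card ≤ B.card → A ⊆ B := by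
    intro A hA B hB hle
    rcases hcomp A hA B hB with h | h
    · exact h
    · exact (Finset.eq_of_subset_of_card_le h hle).ge
  have hinj : Set.InjOn Finset.card (D : Set (Finset X)) := fun A hA B hB e =>
    (hcard A hA B hB e.le).antisymm (hcard B hB A hA e.ge)
  have hk : (D.image Finset.card).card = k := by rw [Finset.card_image_of_injOn hinj, hD]
  let e := (D.image Finset.card).orderEmbOfFin hk
  have hmem : ∀ i, ∃ A ∈ D, A.card = e i := fun i =>
    Finset.mem_image.1 (Finset.orderEmbOfFin_mem _ hk i)
  choose A hA hAe using hmem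
  refine ⟨A, hA, fun i j hij => e.injective ?_, fun i j hij => hcard _ (hA i) _ (hA j) ?_⟩
  · rw [← hAe, ← hAe, hij]
  · rw [hAe, hAe]
    exact e.monotone hij

end Maps

end ZpTucker

/-- **The ℤ_p-Tucker lemma** (Ziegler, Meunier). -/
theorem zp_tucker_lemma (p n m α : ℕ) (hp : p.Prime) (hα : α ≤ m)
    (lam : Finset (ZMod p × Fin n) → ZMod p × ℕ)
    (hrange : ∀ A, IsEFace p n A → 1 ≤ (lam A).2 ∧ (lam A).2 ≤ m)
    (hequiv : ∀ ω : ZMod p, ∀ A, IsEFace p n A →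
      lam (ESmul p n ω A) = (ω + (lam A).1, (lam A).2))
    (h1 : ∀ A₁ A₂, IsEFace p n A₁ → IsEFace p n A₂ → A₁ ⊆ A₂ →
      (lam A₁).2 = (lam A₂).2 → (lam A₁).2 ≤ α → (lam A₁).1 = (lam A₂).1)
    (h2 : ∀ A : Fin p → Finset (ZMod p × Fin n),
      (∀ j, IsEFace p n (A j)) → (∀ i j, i ≤ j → A i ⊆ A j) →
      (∀ i j, (lam (A i)).2 = (lam (A j)).2) → (∀ j, α < (lam (A j)).2) →
      ¬ Function.Injective (fun j => (lam (A j)).1)) :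
    n ≤ α + (m - α) * (p - 1) := by
  have : Fact p.Prime := ⟨hp⟩
  let σ : ZMod p → Finset (ZMod p × ℕ) → Finset (ZMod p × ℕ) :=
    fun ω T => T.image (fun x => (ω + x.1, x.2))
  obtain ⟨s, hs⟩ := ZpTucker.exists_equivariant σ
    (fun T => by simp [σ]) (fun a b T => by
      simp [σ, Finset.image_image, Function.comp_def, add_assoc])
  have hone : ∀ C, ZpTucker.IsFlag p n C → ∀ x ∈ C.image lam, ∀ y ∈ C.image lam,
      x.2 = y.2 → x.2 ≤ α → x = y := by
    intro C hC x hx y hy hxy hxα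
    obtain ⟨A, hA, rfl⟩ := Finset.mem_image.1 hx
    obtain ⟨B, hB, rfl⟩ := Finset.mem_image.1 hy
    refine Prod.ext ?_ hxy
    rcases hC.2.2 A hA B hB with h | h
    · exact h1 A B (hC.2.1 A hA) (hC.2.1 B hB) h hxy hxα
    · exact (h1 B A (hC.2.1 B hB) (hC.2.1 A hA) h hxy.symm (hxy ▸ hxα)).symm
  have hfull : ∀ C, ZpTucker.IsFlag p n C → ∀ j, ∃ a, (a, j) ∉ C.image lam := by
    intro C hC j
    by_contra! hall
    rcases le_or_gt j α with hj | hj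
    · have := congrArg Prod.fst (hone C hC _ (hall 0) _ (hall 1) rfl hj)
      exact zero_ne_one this
    · choose A hA hlam using fun a => Finset.mem_image.1 (hall a)
      have hAinj : Function.Injective A := fun a b hab => by
        have := hlam a
        rw [hab, hlam b] at this
        exact (congrArg Prod.fst this).symm
      obtain ⟨B, hB, hBinj, hBmono⟩ := ZpTucker.exists_monotone_enum (k := p)
        (Finset.univ.image A)
        (by rw [Finset.card_image_of_injective _ hAinj, Finset.card_univ, ZMod.card])
        (by
          intro X hX Y hY
          obtain ⟨a, -, rfl⟩ := Finset.mem_image.1 hX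
          obtain ⟨b, -, rfl⟩ := Finset.mem_image.1 hY
          exact hC.2.2 _ (hA a) _ (hA b))
      have hB' : ∀ i, ∃ a, A a = B i := fun i => by simpa using hB i
      choose b hb using hB'
      have hBlam : ∀ i, lam (B i) = (b i, j) := fun i => by rw [← hb, hlam]
      refine h2 B (fun i => ?_) hBmono (fun i k => by rw [hBlam, hBlam])
        (fun i => by rwa [hBlam]) fun i k hik => hBinj ?_
      · rw [← hb]
        exact hC.2.1 _ (hA _)
      · simp only [hBlam] at hik
        rw [← hb, ← hb, hik]
  refine ZpTucker.le_of_equivariant hp.one_lt _ (fun C => s (C.image lam))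
    (fun C => (C.image lam).card) (fun C hC => ⟨?_, ?_⟩) (fun ω C hC => ?_)
    fun C C' hC hC' hsub => ⟨?_, fun e => ?_⟩
  · exact Finset.card_pos.2 (hC.1.image lam)
  · refine ZpTucker.card_labels_le hp hα _ (fun x hx => ?_) (hone C hC) (hfull C hC)
    obtain ⟨A, hA, rfl⟩ := Finset.mem_image.1 hx
    exact hrange A (hC.2.1 A hA)
  · rw [← hs _ (ZpTucker.eq_zero_of_image_eq (hC.1.image lam) (hfull C hC)) ω]
    congr 1
    simp only [σ, Finset.image_image]
    exact Finset.image_congr fun A hA => hequiv ω A (hC.2.1 A hA)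
  · exact Finset.card_le_card (Finset.image_subset_image hsub)
  · exact congrArg s
      (Finset.eq_of_subset_of_card_le (Finset.image_subset_image hsub) e.ge)
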